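/- Let ζ ∈ S_∞. Then the map η ↦ η∘ζ^{-1} is an order-reversing isomorphism from [e,ζ]_≼ := {η : η ≼ ζ} onto [e,ζ^{-1}]_≼ := {χ : χ ≼ ζ^{-1}}: it is a bijection between these sets, and for all η, η' ≼ ζ one has η ≼ η' if and only if η'∘ζ^{-1} ≼ η∘ζ^{-1}. -/

import Mathlib

/-- `S_∞`: a permutation of the positive integers lies in `S_∞` iff it
fixes all but finitely many integers. -/
def finSupp (w : Equiv.Perm ℕ+) : Prop := {i : ℕ+ | w i ≠ i}.Finite

/-- The length `ℓ(w) = #{(i,j) : i < j and w(i) > w(j)}`. -/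
noncomputable def len (w : Equiv.Perm ℕ+) : ℕ :=
  {p : ℕ+ × ℕ+ | p.1 < p.2 ∧ w p.2 < w p.1}.ncard

/-- Cover relation of the `k`-Bruhat order: `w = u∘(a,b)` with `a ≤ k < b`
and `ℓ(w) = ℓ(u) + 1`. -/
def kBruhatCover (k : ℕ) (u w : Equiv.Perm ℕ+) : Prop :=
  ∃ a b : ℕ+, (a : ℕ) ≤ k ∧ k < (b : ℕ) ∧ w = u * Equiv.swap a b ∧ len w = len u + 1

/-- The `k`-Bruhat order `≤_k`: reflexive–transitive closure of the cover relation. -/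
def kBruhatLE (k : ℕ) : Equiv.Perm ℕ+ → Equiv.Perm ℕ+ → Prop :=
  Relation.ReflTransGen (kBruhatCover k)

/-- The relation `≼` on `S_∞`: `η ≼ ζ` iff there exist a positive integer `k`
and `u ∈ S_∞` with `u ≤_k η∘u ≤_k ζ∘u`. -/
def preceq (η ζ : Equiv.Perm ℕ+) : Prop :=
  ∃ k : ℕ, 0 < k ∧ ∃ u : Equiv.Perm ℕ+, finSupp u ∧
    kBruhatLE k u (η * u) ∧ kBruhatLE k (η * u) (ζ * u)

open Equiv

/-! ### Length and transpositions -/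

theorem finSupp_mul {u v : Perm ℕ+} (hu : finSupp u) (hv : finSupp v) : finSupp (u * v) := by
  refine (Set.Finite.union hu hv).subset fun i hi => ?_
  by_contra h
  simp only [Set.mem_union, Set.mem_ofPred_eq, not_or, not_not] at h
  exact hi (by simp [h.1, h.2])

theorem finSupp_swap (a b : ℕ+) : finSupp (swap a b) := by
  refine (Set.toFinite {a, b}).subset fun i hi => ?_
  by_contra h
  simp only [Set.mem_insert_iff, Set.mem_singleton_iff, not_or] at h
  exact hi (swap_apply_of_ne_of_ne h.1 h.2)

/-- The set of inversions of `w`. -/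
def inversions (w : Perm ℕ+) : Set (ℕ+ × ℕ+) := {p | p.1 < p.2 ∧ w p.2 < w p.1}

theorem finite_inversions {u : Perm ℕ+} (hu : finSupp u) : (inversions u).Finite := by
  obtain ⟨N, hN⟩ := hu.bddAbove
  have fixed : ∀ i, N < i → u i = i := fun i hi => by
    by_contra h
    exact absurd (hN h) (not_le.2 hi)
  have stable : ∀ i, i ≤ N → u i ≤ N := fun i hi => by
    by_contra h
    exact h ((u.injective (fixed _ (not_le.1 h))).trans_le hi)
  refine ((Set.finite_Iic N).prod (Set.finite_Iic N)).subset ?_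
  rintro ⟨i, j⟩ ⟨hij, hji⟩
  have hj : j ≤ N := by
    by_contra h
    have hj := fixed j (not_le.1 h)
    rcases le_or_gt i N with hi | hi
    · have := stable i hi
      simp only at hij hji
      order
    · have := fixed i hi
      simp only at hij hji
      order
  exact ⟨le_trans hij.le hj, hj⟩

/-- Apply `swap a b` to both entries of a pair unless that reverses their order. -/
def swapPair (a b : ℕ+) (p : ℕ+ × ℕ+) : ℕ+ × ℕ+ :=
  if swap a b p.1 < swap a b p.2 then (swap a b p.1, swap a b p.2) else p

theorem swapPair_swapPair {a b : ℕ+} {p : ℕ+ × ℕ+} (hp : p.1 < p.2) :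
    swapPair a b (swapPair a b p) = p := by
  by_cases h : swap a b p.1 < swap a b p.2 <;> simp [swapPair, h, hp]

theorem injOn_swapPair (a b : ℕ+) (u : Perm ℕ+) : Set.InjOn (swapPair a b) (inversions u) :=
  fun p hp q hq h => by rw [← swapPair_swapPair hp.1, h, swapPair_swapPair hq.1]

theorem swapPair_mem_inversions {a b : ℕ+} {u : Perm ℕ+} (hab : a < b) (hu : u a < u b)
    {p : ℕ+ × ℕ+} (hp : p ∈ inversions u) : swapPair a b p ∈ inversions (u * swap a b) := by
  obtain ⟨i, j⟩ := p
  obtain ⟨hij, hji⟩ := hp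
  simp only at hij hji
  by_cases h : swap a b i < swap a b j
  · simp [swapPair, h, inversions, hji]
  · simp only [swapPair, h, if_false, inversions, Set.mem_ofPred_eq, hij, Perm.mul_apply, true_and]
    simp only [swap_apply_def] at h ⊢
    grind

theorem pair_notMem_image_swapPair {a b c : ℕ+} {u : Perm ℕ+} (hac : a < c) (hcb : c ≤ b)
    (hu : u a < u c) : (a, c) ∉ swapPair a b '' inversions u := by
  rintro ⟨p, hp, h⟩
  have hab := lt_of_lt_of_le hac hcb
  have hs : swapPair a b (a, c) = (a, c) := by
    have : ¬ swap a b a < swap a b c := by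
      simp only [swap_apply_def]
      grind
    simp only [swapPair, this, if_false]
  rw [← h, swapPair_swapPair hp.1] at hs
  have := hp.2
  rw [hs, h] at this
  exact absurd this (not_lt.2 hu.le)

theorem len_add_one_le {a b : ℕ+} {u : Perm ℕ+} (hfin : finSupp u) (hab : a < b)
    (hu : u a < u b) : len u + 1 ≤ len (u * swap a b) := by
  have hsub : insert (a, b) (swapPair a b '' inversions u) ⊆ inversions (u * swap a b) := by
    refine Set.insert_subset ⟨hab, by simpa using hu⟩ ?_
    rintro _ ⟨p, hp, rfl⟩
    exact swapPair_mem_inversions hab hu hp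
  have h := Set.ncard_le_ncard hsub (finite_inversions (finSupp_mul hfin (finSupp_swap a b)))
  rwa [Set.ncard_insert_of_notMem (pair_notMem_image_swapPair hab le_rfl hu)
    ((finite_inversions hfin).image _), (injOn_swapPair a b u).ncard_image] at h

theorem len_add_two_le {a b c : ℕ+} {u : Perm ℕ+} (hfin : finSupp u) (hac : a < c) (hcb : c < b)
    (huac : u a < u c) (hucb : u c < u b) : len u + 2 ≤ len (u * swap a b) := by
  have hab := hac.trans hcb
  have hu := huac.trans hucb
  have hsub : insert (a, c) (insert (a, b) (swapPair a b '' inversions u)) ⊆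
      inversions (u * swap a b) := by
    refine Set.insert_subset ⟨hac, ?_⟩ (Set.insert_subset ⟨hab, by simpa using hu⟩ ?_)
    · simpa [swap_apply_of_ne_of_ne hac.ne' hcb.ne] using hucb
    · rintro _ ⟨p, hp, rfl⟩
      exact swapPair_mem_inversions hab hu hp
  have h := Set.ncard_le_ncard hsub (finite_inversions (finSupp_mul hfin (finSupp_swap a b)))
  have hnot : (a, c) ∉ insert (a, b) (swapPair a b '' inversions u) := by
    rintro (h | h)
    · exact hcb.ne (Prod.ext_iff.1 h).2
    · exact pair_notMem_image_swapPair hac hcb.le huac h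
  rwa [Set.ncard_insert_of_notMem hnot (((finite_inversions hfin).image _).insert _),
    Set.ncard_insert_of_notMem (pair_notMem_image_swapPair hab le_rfl hu)
    ((finite_inversions hfin).image _), (injOn_swapPair a b u).ncard_image] at h

theorem len_mul_swap {a b : ℕ+} {u : Perm ℕ+} (hfin : finSupp u) (hab : a < b) (hu : u a < u b)
    (hno : ∀ c, a < c → c < b → ¬ (u a < u c ∧ u c < u b)) :
    len (u * swap a b) = len u + 1 := by
  have hsub : inversions (u * swap a b) ⊆ insert (a, b) (swapPair a b '' inversions u) := by
    rintro ⟨i, j⟩ ⟨hij, hji⟩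
    by_cases hp : (i, j) = (a, b)
    · exact Or.inl hp
    refine Or.inr ⟨swapPair a b (i, j), ?_, swapPair_swapPair hij⟩
    simp only [Perm.mul_apply] at hij hji
    by_cases h : swap a b i < swap a b j
    · simp [swapPair, h, inversions, hji]
    · simp only [swapPair, h, if_false, inversions, Set.mem_ofPred_eq, hij, true_and]
      simp only [Prod.mk.injEq] at hp
      have hne : ∀ x y, x ≠ y → u x < u y ∨ u y < u x := fun x y hxy =>
        lt_or_gt_of_ne fun h => hxy (u.injective h)
      simp only [swap_apply_def] at h hji
      have h1 := hno i
      have h2 := hno j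
      have h3 := hne i a
      have h4 := hne i b
      have h5 := hne j a
      have h6 := hne j b
      grind
  have h := Set.ncard_le_ncard hsub (((finite_inversions hfin).image _).insert _)
  rw [Set.ncard_insert_of_notMem (pair_notMem_image_swapPair hab le_rfl hu)
    ((finite_inversions hfin).image _), (injOn_swapPair a b u).ncard_image] at h
  exact le_antisymm h (len_add_one_le hfin hab hu)

/-! ### The `k`-Bruhat order without lengths -/

theorem kBruhatCover_iff {k : ℕ} {u w : Perm ℕ+} (hfin : finSupp u) :
    kBruhatCover k u w ↔ ∃ a b : ℕ+, (a : ℕ) ≤ k ∧ k < (b : ℕ) ∧ w = u * swap a b ∧ u a < u b ∧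
      ∀ c, a < c → c < b → ¬ (u a < u c ∧ u c < u b) := by
  constructor
  · rintro ⟨a, b, ha, hb, rfl, hlen⟩
    have hab : a < b := PNat.coe_lt_coe _ _ |>.1 (lt_of_le_of_lt ha hb)
    refine ⟨a, b, ha, hb, rfl, ?_, ?_⟩
    · by_contra h
      have hba : u b < u a := lt_of_le_of_ne (not_lt.1 h) fun h => hab.ne' (u.injective h)
      have := len_add_one_le (finSupp_mul hfin (finSupp_swap a b)) hab (by simpa using hba)
      rw [mul_assoc, swap_mul_self, mul_one] at this
      omega
    · rintro c hac hcb ⟨h1, h2⟩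
      have := len_add_two_le hfin hac hcb h1 h2
      omega
  · rintro ⟨a, b, ha, hb, rfl, hu, hno⟩
    exact ⟨a, b, ha, hb, rfl,
      len_mul_swap hfin (PNat.coe_lt_coe _ _ |>.1 (lt_of_le_of_lt ha hb)) hu hno⟩

theorem finSupp_of_cover {k : ℕ} {u w : Perm ℕ+} (hfin : finSupp u) (h : kBruhatCover k u w) :
    finSupp w := by
  obtain ⟨a, b, -, -, rfl, -⟩ := h
  exact finSupp_mul hfin (finSupp_swap a b)

theorem finSupp_of_kBruhatLE {k : ℕ} {u w : Perm ℕ+} (hfin : finSupp u) (h : kBruhatLE k u w) :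
    finSupp w := by
  induction h with
  | refl => exact hfin
  | tail _ h ih => exact finSupp_of_cover ih h

/-- The Bergeron–Sottile conditions satisfied by pairs `u ≤_k w`, in terms of positions. -/
structure Compatible (k : ℕ) (u w : Perm ℕ+) : Prop where
  le_left : ∀ a : ℕ+, (a : ℕ) ≤ k → u a ≤ w a
  le_right : ∀ b : ℕ+, k < (b : ℕ) → w b ≤ u b
  lt_of_lt : ∀ a b : ℕ+, a < b → ((a : ℕ) ≤ k ↔ (b : ℕ) ≤ k) → u a < u b → w a < w b

theorem compatible_of_kBruhatLE {k : ℕ} {u w : Perm ℕ+} (hfin : finSupp u)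
    (h : kBruhatLE k u w) : Compatible k u w := by
  induction h with
  | refl => exact ⟨fun _ _ => le_rfl, fun _ _ => le_rfl, fun _ _ _ _ h => h⟩
  | @tail v w huv hvw ih =>
    obtain ⟨a, b, ha, hb, rfl, hlt, hno⟩ :=
      (kBruhatCover_iff (finSupp_of_kBruhatLE hfin huv)).1 hvw
    have hab : a < b := PNat.coe_lt_coe _ _ |>.1 (lt_of_le_of_lt ha hb)
    refine ⟨fun c hc => ?_, fun c hc => ?_, fun c d hcd hk hu => ?_⟩
    · have := ih.le_left c hc
      simp only [Perm.mul_apply, swap_apply_def]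
      grind
    · have := ih.le_right c hc
      simp only [Perm.mul_apply, swap_apply_def]
      grind
    · have hv := ih.lt_of_lt c d hcd hk hu
      have hc := hno c
      have hd := hno d
      have hvc : c ≠ a → v c ≠ v a := fun h h' => h (v.injective h')
      have hvd : d ≠ b → v d ≠ v b := fun h h' => h (v.injective h')
      have h1 : (a : ℕ) ≤ k → k < (d : ℕ) → a < d := fun h h' =>
        PNat.coe_lt_coe _ _ |>.1 (lt_of_le_of_lt h h')
      have h2 : (d : ℕ) ≤ k → d < b := fun h => PNat.coe_lt_coe _ _ |>.1 (lt_of_le_of_lt h hb)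
      have h3 : ¬ (c : ℕ) ≤ k → a < c := fun h =>
        PNat.coe_lt_coe _ _ |>.1 (lt_of_le_of_lt ha (not_le.1 h))
      simp only [Perm.mul_apply, swap_apply_def]
      have hvb : v d ≠ v a ∨ d = a := or_iff_not_imp_right.2 fun h h' => h (v.injective h')
      have hvb' : v c ≠ v b ∨ c = b := or_iff_not_imp_right.2 fun h h' => h (v.injective h')
      grind

/-! ### Transport of chains -/

theorem cover_of_compatible {k : ℕ} {u w : Perm ℕ+} {a b : ℕ+} (hfin : finSupp u)
    (h : Compatible k u w) (hab : u a < u b) (ha : u b ≤ w a) (hb : w b ≤ u a)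
    (hmid : ∀ x, u a < u x → u x < u b → w b < w x ∧ w x < w a) :
    kBruhatCover k u (u * swap a b) ∧ Compatible k (u * swap a b) w := by
  have hak : (a : ℕ) ≤ k := by
    by_contra hk
    exact absurd (h.le_right a (not_le.1 hk)) (not_le.2 (hab.trans_le ha))
  have hbk : k < (b : ℕ) := by
    by_contra hk
    exact absurd (h.le_left b (not_lt.1 hk)) (not_le.2 (hb.trans_lt hab))
  refine ⟨(kBruhatCover_iff hfin).2 ⟨a, b, hak, hbk, rfl, hab, ?_⟩, ?_, ?_, ?_⟩
  · rintro c hac hcb ⟨h1, h2⟩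
    obtain ⟨h3, h4⟩ := hmid c h1 h2
    by_cases hk : (c : ℕ) ≤ k
    · exact absurd (h.lt_of_lt a c hac (by omega) h1) (not_lt.2 h4.le)
    · exact absurd (h.lt_of_lt c b hcb (by omega) h2) (not_lt.2 h3.le)
  · intro c hc
    have := h.le_left c hc
    simp only [Perm.mul_apply, swap_apply_def]
    grind
  · intro c hc
    have := h.le_right c hc
    simp only [Perm.mul_apply, swap_apply_def]
    grind
  · intro c d hcd hk hlt
    have h1 := h.lt_of_lt c d hcd hk
    have hc := hmid c
    have hd := hmid d
    have hc' : c ≠ b → u c < u b ∨ u b < u c := fun hne =>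
      lt_or_gt_of_ne fun h => hne (u.injective h)
    have hd' : d ≠ a → u d < u a ∨ u a < u d := fun hne =>
      lt_or_gt_of_ne fun h => hne (u.injective h)
    have hc'' : c ≠ a → u c < u a ∨ u a < u c := fun hne =>
      lt_or_gt_of_ne fun h => hne (u.injective h)
    have hd'' : d ≠ b → u d < u b ∨ u b < u d := fun hne =>
      lt_or_gt_of_ne fun h => hne (u.injective h)
    simp only [Perm.mul_apply, swap_apply_def] at hlt
    grind

theorem lt_and_lt_of_cover {k : ℕ} {u w : Perm ℕ+} {a b : ℕ+} (ha : (a : ℕ) ≤ k)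
    (hb : k < (b : ℕ)) (hno : ∀ c, a < c → c < b → ¬ (u a < u c ∧ u c < u b))
    (h : Compatible k (u * swap a b) w) {y : ℕ+} (hay : u a < u y) (hyb : u y < u b) :
    w b < w y ∧ w y < w a := by
  have hya : y ≠ a := by rintro rfl; exact lt_irrefl _ hay
  have hyb' : y ≠ b := by rintro rfl; exact lt_irrefl _ hyb
  have h1 : u b ≤ w a := by simpa using h.le_left a ha
  have h2 : w b ≤ u a := by simpa using h.le_right b hb
  by_cases hk : (y : ℕ) ≤ k
  · have h3 : u y ≤ w y := by
      simpa [swap_apply_of_ne_of_ne hya hyb'] using h.le_left y hk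
    refine ⟨by order, ?_⟩
    have hyltb : y < b := (PNat.coe_lt_coe _ _).1 (lt_of_le_of_lt hk hb)
    have hylta : y < a := lt_of_le_of_ne (not_lt.1 fun h => hno y h hyltb ⟨hay, hyb⟩) hya
    exact h.lt_of_lt y a hylta (by omega) (by simpa [swap_apply_of_ne_of_ne hya hyb'] using hyb)
  · have h3 : w y ≤ u y := by
      simpa [swap_apply_of_ne_of_ne hya hyb'] using h.le_right y (not_le.1 hk)
    refine ⟨?_, by order⟩
    have halty : a < y := (PNat.coe_lt_coe _ _).1 (lt_of_le_of_lt ha (not_le.1 hk))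
    have hblty : b < y := lt_of_le_of_ne (not_lt.1 fun h => hno y halty h ⟨hay, hyb⟩) hyb'.symm
    exact h.lt_of_lt b y hblty (by omega) (by simpa [swap_apply_of_ne_of_ne hya hyb'] using hay)

/-- A cover starting an interval `[u, w]_k` is transported to every `u'` that is compatible
with the same value permutation `w * u⁻¹`. -/
theorem cover_transport {k k' : ℕ} {u v w u' w' : Perm ℕ+} (hfin : finSupp u)
    (hfin' : finSupp u') (huv : kBruhatCover k u v) (hvw : Compatible k v w)
    (h' : Compatible k' u' w') (hw : w' * u'⁻¹ = w * u⁻¹) :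
    kBruhatCover k' u' (v * u⁻¹ * u') ∧ Compatible k' (v * u⁻¹ * u') w' := by
  obtain ⟨a, b, ha, hb, rfl, hlt, hno⟩ := (kBruhatCover_iff hfin).1 huv
  obtain ⟨f, rfl⟩ : ∃ f, u' = u * f := ⟨u⁻¹ * u', by group⟩
  obtain rfl : w' = w * f := by
    rw [mul_inv_rev, ← mul_assoc] at hw
    exact mul_inv_eq_iff_eq_mul.1 (mul_right_cancel hw)
  obtain ⟨a, rfl⟩ := f.surjective a
  obtain ⟨b, rfl⟩ := f.surjective b
  have hv : u * swap (f a) (f b) * u⁻¹ * (u * f) = u * f * swap a b := by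
    rw [mul_assoc u f, Equiv.mul_swap_eq_swap_mul f]
    group
  rw [hv]
  refine cover_of_compatible hfin' h' hlt ?_ ?_ fun x => lt_and_lt_of_cover ha hb hno hvw
  · simpa using hvw.le_left _ ha
  · simpa using hvw.le_right _ hb

theorem kBruhatLE_transport {k k' : ℕ} {u v w u' w' : Perm ℕ+} (hfin : finSupp u)
    (hfin' : finSupp u') (huv : kBruhatLE k u v) (hvw : kBruhatLE k v w)
    (h' : Compatible k' u' w') (hw : w' * u'⁻¹ = w * u⁻¹) :
    kBruhatLE k' u' (v * u⁻¹ * u') ∧ Compatible k' (v * u⁻¹ * u') w' := by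
  induction huv using Relation.ReflTransGen.head_induction_on generalizing u' with
  | refl =>
    rw [mul_inv_cancel, one_mul]
    exact ⟨.refl, h'⟩
  | @head u x hux hxv ih =>
    have hx := finSupp_of_cover hfin hux
    obtain ⟨hcov, hcomp⟩ := cover_transport hfin hfin' hux
      (compatible_of_kBruhatLE hx (Relation.ReflTransGen.trans hxv hvw)) h' hw
    have := ih hx (finSupp_of_cover hfin' hcov) hcomp (by
      rw [mul_inv_rev, ← mul_assoc, hw]
      group)
    have hv : v * x⁻¹ * (x * u⁻¹ * u') = v * u⁻¹ * u' := by group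
    rw [hv] at this
    exact ⟨.head hcov this.1, this.2⟩

/-- Whether `η u` lies in the interval `[u, ζ u]_k` does not depend on `u` and `k`. -/
theorem kBruhatLE_of_kBruhatLE {k k' : ℕ} {u u' η ζ : Perm ℕ+} (hfin : finSupp u)
    (hfin' : finSupp u') (h₁ : kBruhatLE k u (η * u)) (h₂ : kBruhatLE k (η * u) (ζ * u))
    (h : kBruhatLE k' u' (ζ * u')) :
    kBruhatLE k' u' (η * u') ∧ kBruhatLE k' (η * u') (ζ * u') := by
  obtain ⟨h₃, hc⟩ := kBruhatLE_transport hfin hfin' h₁ h₂ (compatible_of_kBruhatLE hfin' h)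
    (by group)
  rw [mul_inv_cancel_right] at h₃ hc
  have h₄ := (kBruhatLE_transport (finSupp_of_kBruhatLE hfin h₁) (finSupp_of_kBruhatLE hfin' h₃)
    h₂ .refl hc (by group)).1
  have hv : ζ * u * (η * u)⁻¹ * (η * u') = ζ * u' := by group
  rw [hv] at h₄
  exact ⟨h₃, h₄⟩

/-! ### Reversal of positions -/

/-- The longest element of `S_n`, reversing `1, …, n`. -/
def reversal (n : ℕ+) : Perm ℕ+ :=
  Function.Involutive.toPerm (fun i => if i ≤ n then n + 1 - i else i) fun i => by
    by_cases h : i ≤ n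
    · have h1 : i < n + 1 := PNat.lt_add_one_iff.2 h
      have h2 : ((n + 1 - i : ℕ+) : ℕ) = n + 1 - i := by simp [PNat.sub_coe, h1]
      have h3 : n + 1 - i ≤ n := by
        rw [← PNat.coe_le_coe, h2]
        have := i.pos
        omega
      simp only [h, h3, if_true]
      apply PNat.eq
      have h4 : n + 1 - i < n + 1 := PNat.lt_add_one_iff.2 h3
      rw [PNat.sub_coe, if_pos h4, h2]
      have h5 : (i : ℕ) < n + 1 := by exact_mod_cast h1
      simp only [PNat.add_coe, PNat.one_coe]
      omega
    · simp [h]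

theorem reversal_apply (n i : ℕ+) : reversal n i = if i ≤ n then n + 1 - i else i := rfl

theorem reversal_reversal (n i : ℕ+) : reversal n (reversal n i) = i :=
  (reversal n).symm_apply_apply i

theorem coe_reversal {n i : ℕ+} (h : i ≤ n) : (reversal n i : ℕ) = n + 1 - i := by
  have h1 : i < n + 1 := PNat.lt_add_one_iff.2 h
  simp [reversal_apply, h, PNat.sub_coe, h1]

theorem reversal_of_lt {n i : ℕ+} (h : n < i) : reversal n i = i := by
  simp [reversal_apply, not_le.2 h]

theorem finSupp_reversal (n : ℕ+) : finSupp (reversal n) := by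
  refine (Set.finite_Iic n).subset fun i hi => ?_
  by_contra h
  exact hi (reversal_of_lt (not_le.1 h))

theorem reversal_lt_reversal {n i j : ℕ+} (hj : j ≤ n) (hij : i < j) :
    reversal n j < reversal n i := by
  rw [← PNat.coe_lt_coe, coe_reversal hj, coe_reversal (hij.le.trans hj)]
  have := (PNat.coe_lt_coe _ _).2 hij
  have := (PNat.coe_le_coe _ _).2 hj
  omega

theorem reversal_le {n i : ℕ+} (h : i ≤ n) : reversal n i ≤ n := by
  rw [← PNat.coe_le_coe, coe_reversal h]
  have := i.pos
  omega

theorem cover_mul_reversal {k : ℕ} {u w : Perm ℕ+} (hfin : finSupp u)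
    (h : kBruhatCover k u w) :
    ∃ N : ℕ+, ∀ n ≥ N, kBruhatCover (n - k) (w * reversal n) (u * reversal n) := by
  have hfinw := finSupp_of_cover hfin h
  obtain ⟨a, b, ha, hb, rfl, hlt, hno⟩ := (kBruhatCover_iff hfin).1 h
  have hab : a < b := (PNat.coe_lt_coe _ _).1 (lt_of_le_of_lt ha hb)
  refine ⟨b, fun n hn => (kBruhatCover_iff (finSupp_mul hfinw (finSupp_reversal n))).2
    ⟨reversal n b, reversal n a, ?_, ?_, ?_, ?_, ?_⟩⟩
  · rw [coe_reversal hn]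
    omega
  · rw [coe_reversal (hab.le.trans hn)]
    have := (PNat.coe_le_coe _ _).2 hn
    omega
  · rw [mul_assoc _ (reversal n), Equiv.mul_swap_eq_swap_mul (reversal n), reversal_reversal,
      reversal_reversal, swap_comm b a, mul_assoc, swap_mul_self_mul]
  · simpa [reversal_reversal] using hlt
  · intro c hbc hca
    have hcn : c ≤ n := hca.le.trans (reversal_le (hab.le.trans hn))
    have h1 := reversal_lt_reversal hcn hbc
    have h2 := reversal_lt_reversal (reversal_le (hab.le.trans hn)) hca
    rw [reversal_reversal] at h1 h2
    have := hno _ h2 h1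
    simpa [reversal_reversal, swap_apply_of_ne_of_ne h2.ne' h1.ne] using this

theorem kBruhatLE_mul_reversal {k : ℕ} {u w : Perm ℕ+} (hfin : finSupp u)
    (h : kBruhatLE k u w) :
    ∃ N : ℕ+, ∀ n ≥ N, kBruhatLE (n - k) (w * reversal n) (u * reversal n) := by
  induction h with
  | refl => exact ⟨1, fun _ _ => .refl⟩
  | tail huv hvw ih =>
    obtain ⟨N, hN⟩ := ih
    obtain ⟨M, hM⟩ := cover_mul_reversal (finSupp_of_kBruhatLE hfin huv) hvw
    exact ⟨max N M, fun n hn => .head (hM n (le_of_max_le_right hn)) (hN n (le_of_max_le_left hn))⟩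

/-! ### The relation `≼` -/

theorem one_preceq {η ζ : Perm ℕ+} (h : preceq η ζ) : preceq 1 η := by
  obtain ⟨k, hk, u, hu, h₁, -⟩ := h
  exact ⟨k, hk, u, hu, by rw [one_mul]; exact .refl, by rwa [one_mul]⟩

theorem preceq_mul_inv {η η' ζ : Perm ℕ+} (h : preceq η η') (h' : preceq η' ζ) :
    preceq (η' * ζ⁻¹) (η * ζ⁻¹) := by
  obtain ⟨l, -, v, hv, h₁, h₂⟩ := h
  obtain ⟨k, -, u, hu, h₃, h₄⟩ := h'
  obtain ⟨h₅, h₆⟩ := kBruhatLE_of_kBruhatLE hv hu h₁ h₂ h₃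
  have hη := finSupp_of_kBruhatLE hu h₅
  have hη' := finSupp_of_kBruhatLE hu h₃
  obtain ⟨N, hN⟩ := kBruhatLE_mul_reversal hη h₆
  obtain ⟨M, hM⟩ := kBruhatLE_mul_reversal hη' h₄
  set n : ℕ+ := max (max N M) k.succPNat with hn
  have hk : k < (n : ℕ) := by
    have := (PNat.coe_le_coe _ _).2 (le_max_right (max N M) k.succPNat)
    rw [Nat.succPNat_coe, ← hn] at this
    omega
  refine ⟨n - k, by omega, ζ * u * reversal n,
    finSupp_mul (finSupp_of_kBruhatLE hη' h₄) (finSupp_reversal n), ?_, ?_⟩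
  · have := hM n ((le_max_right _ _).trans (le_max_left _ _))
    simpa [mul_assoc] using this
  · have := hN n ((le_max_left _ _).trans (le_max_left _ _))
    simpa [mul_assoc] using this

theorem mul_inv_preceq_inv {η ζ : Perm ℕ+} (h : preceq η ζ) : preceq (η * ζ⁻¹) ζ⁻¹ := by
  simpa using preceq_mul_inv (one_preceq h) h

/-- Theorem 3.2.3(vi): `η ↦ η∘ζ⁻¹` is an order-reversing isomorphism
`[e,ζ]_≼ ≅ [e,ζ⁻¹]_≼`. -/
theorem stmt12 (ζ : Equiv.Perm ℕ+) (hζ : finSupp ζ) :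
    Set.BijOn (fun η => η * ζ⁻¹) {η | preceq η ζ} {χ | preceq χ ζ⁻¹} ∧
    ∀ η η' : Equiv.Perm ℕ+, preceq η ζ → preceq η' ζ →
      (preceq η η' ↔ preceq (η' * ζ⁻¹) (η * ζ⁻¹)) := by
  refine ⟨⟨fun η h => mul_inv_preceq_inv h, (mul_left_injective ζ⁻¹).injOn, fun χ h => ?_⟩,
    fun η η' h h' => ⟨fun hle => preceq_mul_inv hle h', fun hle => ?_⟩⟩
  · exact ⟨χ * ζ, by simpa using mul_inv_preceq_inv h, by simp⟩
  · simpa using preceq_mul_inv hle (mul_inv_preceq_inv h)
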